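/- Let V : ℕ → ℕ be a finitely supported function (V i is the number of vertices of degree i), and let E, F be natural numbers such that: V 0 = 0 and V 1 = 0 (every vertex has degree at least 2); Euler's formula holds, i.e. (∑ i, V i) - E + F = 2 as integers; every face is a 4-gon, i.e. E = 2·F; and the degree-sum formula holds, i.e. 2·E = ∑ i, i · V i. Then 2 · V 2 + V 3 ≥ 8. (In particular, such a graph has at least one vertex of degree 2 or 3.) -/

import Mathlib

/-- Euler characteristic counting argument (Lemma 3.7, following Birman–Menasco):
if every vertex has degree at least 2, Euler's formula holds, every face is a 4-gon,
and the degree-sum formula holds, then `2 * V 2 + V 3 ≥ 8`. -/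
theorem stmt_0 (V : ℕ → ℕ) (hfin : (Function.support V).Finite)
    (E F : ℕ) (h0 : V 0 = 0) (h1 : V 1 = 0)
    (heuler : (∑ᶠ i, (V i : ℤ)) - (E : ℤ) + (F : ℤ) = 2)
    (hface : E = 2 * F)
    (hdeg : 2 * E = ∑ᶠ i, i * V i) :
    2 * V 2 + V 3 ≥ 8 := by
  set s : Finset ℕ := hfin.toFinset ∪ {2, 3} with hs
  have mem_s : ∀ i, V i ≠ 0 → i ∈ s := fun i hi => by simp [hs, hi]
  rw [finsum_eq_sum_of_support_subset (s := s) _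
    (fun i hi => mem_s i (by simpa using hi))] at heuler
  rw [finsum_eq_sum_of_support_subset (s := s) _
    (fun i hi => mem_s i (right_ne_zero_of_mul hi))] at hdeg
  have hdeg' : 2 * (E : ℤ) = ∑ i ∈ s, (i : ℤ) * V i := by exact_mod_cast hdeg
  have hbound : ∑ i ∈ s, (4 - (i : ℤ)) * V i ≤
      ∑ i ∈ s, ((if i = 2 then 2 * (V 2 : ℤ) else 0) + if i = 3 then (V 3 : ℤ) else 0) := by
    refine Finset.sum_le_sum fun i _ => ?_
    match i with
    | 0 => simp [h0]
    | 1 => simp [h1]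
    | 2 => norm_num
    | 3 => norm_num
    | n + 4 =>
      have : (0 : ℤ) ≤ n * V (n + 4) := by positivity
      simp
      linarith
  have h2 : 2 ∈ s := by simp [hs]
  have h3 : 3 ∈ s := by simp [hs]
  simp only [sub_mul, Finset.sum_sub_distrib, ← Finset.mul_sum, Finset.sum_add_distrib,
    Finset.sum_ite_eq', h2, h3, if_true] at hbound
  omega
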